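/- arXiv:2201.05656 — 3 statements merged into one kernel-verified Lean document; each statement's English description precedes it below -/
import Mathlib

section
/- There exists a constant C > 0 depending only on Σ such that the following holds: if k is a positive integer, every element of S has length at least k, and there exists t ∈ (1, λ^k) with r = (1 + k·C·λ^{2k}·p(t^{1/k}/λ))/t < 1, then h(Σ) − h(Σ⟨S⟩) ≤ −log(1 − r)/k. -/
open Filter MeasureTheory
open scoped BigOperators

namespace SFT

/-- A finite word `x_1 ⋯ x_m` is admissible if the `(x_{j+1}, x_j)` entry of `T`
equals `1` for all `1 ≤ j < m`. -/
def Admissible {n : ℕ} (T : Matrix (Fin n) (Fin n) ℝ) (w : List (Fin n)) : Prop :=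
  w.Chain' fun a b => T b a = 1

/-- The subshift of finite type `Σ` determined by `T`: bi-infinite sequences with
all transitions allowed. -/
def SFTspace {n : ℕ} (T : Matrix (Fin n) (Fin n) ℝ) : Set (ℤ → Fin n) :=
  {x | ∀ i : ℤ, T (x (i + 1)) (x i) = 1}

/-- The word `w` occurs in the bi-infinite sequence `x` starting at coordinate `a`. -/
def OccursAt {A : Type*} (w : List A) (x : ℤ → A) (a : ℤ) : Prop :=
  ∀ (j : ℕ) (h : j < w.length), x (a + j) = w.get ⟨j, h⟩

/-- The word `w` occurs somewhere in the bi-infinite sequence `x`. -/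
def Occurs {A : Type*} (w : List A) (x : ℤ → A) : Prop :=
  ∃ a : ℤ, OccursAt w x a

/-- `N_X(m)`: the number of words of length `m` occurring in elements of `X`. -/
noncomputable def wordCount {A : Type*} (X : Set (ℤ → A)) (m : ℕ) : ℕ :=
  {w : List A | w.length = m ∧ ∃ x ∈ X, Occurs w x}.ncard

/-- The entropy `h(X) = lim_{m→∞} (1/m) log N_X(m)` of a subshift (for subshifts the
limit exists, hence coincides with the limsup used here). -/
noncomputable def entropy {A : Type*} (X : Set (ℤ → A)) : ℝ :=
  Filter.atTop.limsup fun m : ℕ => Real.log (wordCount X m) / m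

/-- `Σ⟨S⟩`: the elements of `Σ` in which no word of `S` occurs. -/
def Avoid {n : ℕ} (T : Matrix (Fin n) (Fin n) ℝ) (S : Finset (List (Fin n))) :
    Set (ℤ → Fin n) :=
  {x ∈ SFTspace T | ∀ τ ∈ S, ¬ Occurs τ x}

/-- `p(t) = ∑_{τ ∈ S} t^{|τ|}`. -/
noncomputable def wordPoly {n : ℕ} (S : Finset (List (Fin n))) (t : ℝ) : ℝ :=
  ∑ τ ∈ S, t ^ τ.length

/-- The cylinder set `[σ]` (inside `Σ`), with `σ` beginning at coordinate `0`.
It is empty when `σ` is not admissible. -/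
def cylinder {n : ℕ} (T : Matrix (Fin n) (Fin n) ℝ) (σ : List (Fin n)) :
    Set (ℤ → Fin n) :=
  {x ∈ SFTspace T | OccursAt σ x 0}

/-- `N(σ, k)`: the number of words `η` of length `k` such that `ση` is admissible. -/
noncomputable def extCount {n : ℕ} (T : Matrix (Fin n) (Fin n) ℝ) (σ : List (Fin n))
    (k : ℕ) : ℕ :=
  {η : List (Fin n) | η.length = k ∧ Admissible T (σ ++ η)}.ncard

/-- A word is `S`-free if no element of `S` occurs in it as a consecutive subword. -/
def SFree {A : Type*} (S : Finset (List A)) (w : List A) : Prop :=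
  ∀ τ ∈ S, ¬ τ <:+: w

open Classical in
/-- `f_σ(α) = ∑_{τ ∈ S} ∑_j t^j`, the inner sum over integers `j ≥ 0` such that `τ`
occurs in `α` beginning within `σ` (placed at coordinate `0`) and ending `j` symbols
beyond the end of `σ`. -/
noncomputable def fword {n : ℕ} (S : Finset (List (Fin n))) (t : ℝ) (σ : List (Fin n))
    (x : ℤ → Fin n) : ℝ :=
  ∑ τ ∈ S, ∑ j ∈ Finset.range τ.length,
    if τ.length ≤ σ.length + j ∧ OccursAt τ x ((σ.length : ℤ) + j - τ.length)
    then t ^ j else 0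

/-- The weight `w(σ) = (1/μ([σ])) ∫_{[σ]} f_σ dμ`. -/
noncomputable def weight {n : ℕ} (T : Matrix (Fin n) (Fin n) ℝ)
    (μ : Measure (ℤ → Fin n)) (S : Finset (List (Fin n))) (t : ℝ)
    (σ : List (Fin n)) : ℝ :=
  (∫ x in cylinder T σ, fword S t σ x ∂μ) / (μ (cylinder T σ)).toReal

/-- `p_σ = ∑_{τ ∈ S} (μ([στ])/μ([σ])) t^{|τ|}`. -/
noncomputable def pWord {n : ℕ} (T : Matrix (Fin n) (Fin n) ℝ)
    (μ : Measure (ℤ → Fin n)) (S : Finset (List (Fin n))) (t : ℝ)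
    (σ : List (Fin n)) : ℝ :=
  ∑ τ ∈ S, (μ (cylinder T (σ ++ τ))).toReal / (μ (cylinder T σ)).toReal * t ^ τ.length

/-- `S_{σ,j}`: the subset of `[σ]` of elements containing some `τ ∈ S` that begins
within `σ` and ends `j` symbols after the end of `σ`. -/
def Ssub {n : ℕ} (T : Matrix (Fin n) (Fin n) ℝ) (S : Finset (List (Fin n)))
    (σ : List (Fin n)) (j : ℕ) : Set (ℤ → Fin n) :=
  {x ∈ cylinder T σ | ∃ τ ∈ S, τ.length ≤ σ.length + j ∧ j < τ.length ∧
    OccursAt τ x ((σ.length : ℤ) + j - τ.length)}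

/-- `η` is a good extension of an `S`-free word `σ`: `ση` is admissible and every
intermediate word between `σ` and `ση` (inclusive) has weight `< 1`. -/
def GoodExt {n : ℕ} (T : Matrix (Fin n) (Fin n) ℝ) (μ : Measure (ℤ → Fin n))
    (S : Finset (List (Fin n))) (t : ℝ) (σ η : List (Fin n)) : Prop :=
  Admissible T (σ ++ η) ∧ ∀ η', η' <+: η → weight T μ S t (σ ++ η') < 1

/-- `G(σ, m)`: union of the cylinder sets `[ση]` over good `η` of length `m`. -/
def GSet {n : ℕ} (T : Matrix (Fin n) (Fin n) ℝ) (μ : Measure (ℤ → Fin n))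
    (S : Finset (List (Fin n))) (t : ℝ) (σ : List (Fin n)) (m : ℕ) :
    Set (ℤ → Fin n) :=
  ⋃ η ∈ {η : List (Fin n) | η.length = m ∧ GoodExt T μ S t σ η}, cylinder T (σ ++ η)

/-- The alphabet of `Σ_k`: admissible words of length `k` in `Σ`. -/
def BlockAlphabet {n : ℕ} (T : Matrix (Fin n) (Fin n) ℝ) (k : ℕ) :=
  {w : List (Fin n) // w.length = k ∧ Admissible T w}

/-- `Σ_k`: the SFT on admissible `k`-blocks, where `[x_1⋯x_k][y_1⋯y_k]` is an
allowed transition iff `x_k y_1` is admissible in `Σ`. -/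
def SigmaBlock {n : ℕ} [NeZero n] (T : Matrix (Fin n) (Fin n) ℝ) (k : ℕ) :
    Set (ℤ → BlockAlphabet T k) :=
  {y | ∀ i : ℤ, T ((y (i + 1)).val.head!) ((y i).val.getLast!) = 1}

/-- The natural block-concatenation map `Σ_k → Σ`. -/
def blockConcat {n : ℕ} [NeZero n] (T : Matrix (Fin n) (Fin n) ℝ) (k : ℕ)
    (y : ℤ → BlockAlphabet T k) : ℤ → Fin n :=
  fun m => (y (Int.fdiv m k)).val.getD (Int.fmod m k).toNat default



theorem sub_le_of_recurrence {ι : Type*} (S : Finset ι) (len : ι → ℕ) (a : ℕ → ℝ)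
    (ha : ∀ m, 0 ≤ a m) (hanti : Antitone a) {K lam s t : ℝ} (hK : 0 ≤ K) (hlam : 0 < lam)
    (hrec : ∀ m, a m - a (m + 1) ≤
      K * ∑ τ ∈ S with len τ ≤ m + 1, (lam⁻¹) ^ len τ * a (m + 1 - len τ))
    {k : ℕ} (hlen : ∀ τ ∈ S, k ≤ len τ) (hs : 1 ≤ s) (hst : s ^ k = t)
    (hk : 1 ≤ k) (hq : 1 / t ≤ 1 - k * K * t * ∑ τ ∈ S, (s / lam) ^ len τ) (m : ℕ) :
    (1 - k * K * t * ∑ τ ∈ S, (s / lam) ^ len τ) * a m ≤ a (m + k) := by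
  have ht : 1 ≤ t := hst ▸ one_le_pow₀ hs
  induction m using Nat.strong_induction_on with
  | _ m ih =>
    have step : ∀ j < m, a j ≤ t * a (j + k) := by
      intro j hj
      have h1 := (mul_le_mul_of_nonneg_right hq (ha j)).trans (ih j hj)
      rw [one_div, inv_mul_le_iff₀ (by linarith)] at h1
      exact h1
    have far : ∀ e d, d + e = m → a d ≤ t * s ^ e * a m := by
      intro e
      induction e using Nat.strong_induction_on with
      | _ e ihe =>
        intro d hd
        rcases Nat.eq_zero_or_pos e with rfl | he
        · have : d = m := by omega
          subst this
          have := mul_le_mul_of_nonneg_right ht (ha d)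
          simpa using this
        rcases lt_or_ge e k with hek | hek
        · have h1 := step d (by omega)
          have h2 : a (d + k) ≤ a m := hanti (by omega)
          have h3 : t * a (d + k) ≤ t * a m := by gcongr
          have h4 : t * 1 * a m ≤ t * s ^ e * a m := by
            have := ha m
            gcongr
            exact one_le_pow₀ hs
          linarith
        · have h1 := step d (by omega)
          have h2 := ihe (e - k) (by omega) (d + k) (by omega)
          have h3 : s ^ e = t * s ^ (e - k) := by
            rw [← hst, ← pow_add]; congr 1; omega
          calc a d ≤ t * a (d + k) := h1
            _ ≤ t * (t * s ^ (e - k) * a m) := by gcongr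
            _ = t * s ^ e * a m := by rw [h3]; ring
    have one : ∀ i < k, a (m + i) - a (m + (i + 1)) ≤
        K * (t * (∑ τ ∈ S, (s / lam) ^ len τ) * a m) := by
      intro i hi
      refine (hrec (m + i)).trans ?_
      gcongr
      rw [Finset.mul_sum, Finset.sum_mul]
      refine (Finset.sum_le_sum fun τ hτ => ?_).trans
        (Finset.sum_le_sum_of_subset_of_nonneg (Finset.filter_subset _ _) fun τ _ _ => ?_)
      · obtain ⟨hτS, hτ⟩ := Finset.mem_filter.1 hτ
        have hl := hlen τ hτS
        have h1 := far (len τ - (i + 1)) (m + i + 1 - len τ) (by omega)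
        have h2 : s ^ (len τ - (i + 1)) ≤ s ^ len τ := pow_le_pow_right₀ hs (by omega)
        have h3 := ha m
        calc (lam⁻¹) ^ len τ * a (m + i + 1 - len τ)
            ≤ (lam⁻¹) ^ len τ * (t * s ^ len τ * a m) := by
              gcongr
              exact h1.trans (by gcongr)
          _ = t * (s / lam) ^ len τ * a m := by rw [div_eq_mul_inv, mul_pow]; ring
      · have h3 := ha m
        positivity
    have tel : a m - a (m + k) = ∑ i ∈ Finset.range k, (a (m + i) - a (m + (i + 1))) := by
      rw [Finset.sum_range_sub' (fun i => a (m + i))]; simp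
    have h := Finset.sum_le_sum fun i hi => one i (Finset.mem_range.1 hi)
    rw [← tel, Finset.sum_const, Finset.card_range, nsmul_eq_mul] at h
    linarith

theorem le_of_forall_mul_pow_le {c D x y : ℝ} (hc : 0 < c) (hx : 0 < x) (hy : 0 ≤ y)
    (h : ∀ j : ℕ, c * x ^ j ≤ D * y ^ j) : x ≤ y := by
  by_contra! hlt
  have h1 : Tendsto (fun j : ℕ => D * (y / x) ^ j) atTop (nhds (D * 0)) :=
    (tendsto_pow_atTop_nhds_zero_of_lt_one (by positivity) ((div_lt_one hx).2 hlt)).const_mul D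
  have h2 : c ≤ D * 0 := ge_of_tendsto' h1 fun j => by
    rw [div_pow, ← mul_div_assoc, le_div_iff₀ (by positivity)]
    exact h j
  linarith

theorem mul_pow_le_of_block_contraction (a : ℕ → ℝ) (hanti : Antitone a)
    (ha0 : 0 ≤ a 0) {θ : ℝ} (hθ : 0 < θ) (hθ1 : θ ≤ 1) {k : ℕ} (hk : 1 ≤ k)
    (h : ∀ m, θ ^ k * a m ≤ a (m + k)) (m : ℕ) : θ ^ k * θ ^ m * a 0 ≤ a m := by
  have hj : ∀ j, θ ^ (k * j) * a 0 ≤ a (k * j) := by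
    intro j
    induction j with
    | zero => simp
    | succ j ih =>
      calc θ ^ (k * (j + 1)) * a 0 = θ ^ k * (θ ^ (k * j) * a 0) := by ring
        _ ≤ θ ^ k * a (k * j) := by gcongr
        _ ≤ _ := h _
  have h1 : k * (m / k) ≤ m := Nat.mul_div_le m k
  have h2 : m ≤ k * (m / k + 1) := (Nat.lt_mul_div_succ m hk).le
  calc θ ^ k * θ ^ m * a 0 ≤ θ ^ (k * (m / k + 1)) * a 0 := by
        gcongr ?_ * _
        rw [← pow_add]
        exact pow_le_pow_of_le_one hθ.le hθ1 (by rw [mul_add]; omega)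
    _ ≤ a (k * (m / k + 1)) := hj _
    _ ≤ a m := hanti h2

section

variable {n : ℕ}

open Classical in
/-- The admissible `S`-free words of length `m`. -/
noncomputable def freeWords (T : Matrix (Fin n) (Fin n) ℝ) (S : Finset (List (Fin n))) (m : ℕ) :
    Finset (List (Fin n)) :=
  (List.finite_length_eq (Fin n) m).toFinset.filter fun w => Admissible T w ∧ SFree S w

theorem mem_freeWords {T : Matrix (Fin n) (Fin n) ℝ} {S : Finset (List (Fin n))} {m : ℕ}
    {w : List (Fin n)} :
    w ∈ freeWords T S m ↔ w.length = m ∧ Admissible T w ∧ SFree S w := by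
  simp [freeWords]

theorem SFree.of_infix {A : Type*} {S : Finset (List A)} {w w' : List A} (h : SFree S w)
    (hw : w' <:+: w) : SFree S w' := fun τ hτ h' => h τ hτ (h'.trans hw)

theorem admissible_iff {T : Matrix (Fin n) (Fin n) ℝ} {w : List (Fin n)} :
    Admissible T w ↔ w.IsChain fun a b => T b a = 1 := Iff.rfl

theorem Admissible.of_infix {T : Matrix (Fin n) (Fin n) ℝ} {w w' : List (Fin n)}
    (h : Admissible T w) (hw : w' <:+: w) : Admissible T w' :=
  List.IsChain.infix h hw

/-- The value of a word under the eigenvector `v`, read off at its first letter; the value of the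
empty word makes `sum_wordValue_cons` hold for it, too. -/
noncomputable def wordValue (v : Fin n → ℝ) (lam : ℝ) : List (Fin n) → ℝ
  | [] => (∑ a, v a) / lam
  | a :: _ => v a

open Classical in
theorem sum_wordValue_cons {T : Matrix (Fin n) (Fin n) ℝ} {lam : ℝ} {v : Fin n → ℝ}
    (hT01 : ∀ i j, T i j = 0 ∨ T i j = 1) (hlam : lam ≠ 0) (hv : T.mulVec v = lam • v)
    {w : List (Fin n)} (hw : Admissible T w) :
    ∑ a with Admissible T (a :: w), wordValue v lam (a :: w) = lam * wordValue v lam w := by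
  cases w with
  | nil => simp [admissible_iff, wordValue]; field_simp
  | cons b w =>
    have h := congrFun hv b
    simp only [Matrix.mulVec, dotProduct, Pi.smul_apply, smul_eq_mul] at h
    simp only [wordValue, ← h, Finset.sum_filter]
    refine Finset.sum_congr rfl fun a _ => ?_
    have : Admissible T (a :: b :: w) ↔ T b a = 1 := by
      simp only [admissible_iff, List.isChain_cons_cons] at hw ⊢
      tauto
    rcases hT01 b a with h0 | h0 <;> simp [this, h0]

/-- The total value of the `S`-free admissible words of length `m`. -/
noncomputable def freeMass (T : Matrix (Fin n) (Fin n) ℝ) (S : Finset (List (Fin n)))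
    (v : Fin n → ℝ) (lam : ℝ) (m : ℕ) : ℝ :=
  ∑ w ∈ freeWords T S m, wordValue v lam w

open Classical in
/-- The admissible words with one letter prepended to an `S`-free word of length `m`. -/
noncomputable def consWords (T : Matrix (Fin n) (Fin n) ℝ) (S : Finset (List (Fin n))) (m : ℕ) :
    Finset (List (Fin n)) :=
  ((freeWords T S m).sigma fun w => Finset.univ.filter fun a => Admissible T (a :: w)).image
    fun x => x.2 :: x.1

theorem mem_consWords {T : Matrix (Fin n) (Fin n) ℝ} {S : Finset (List (Fin n))} {m : ℕ}
    {u : List (Fin n)} :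
    u ∈ consWords T S m ↔ ∃ a, ∃ w ∈ freeWords T S m, Admissible T (a :: w) ∧ a :: w = u := by
  classical
  simp only [consWords, Finset.mem_image, Finset.mem_sigma, Finset.mem_filter, Finset.mem_univ,
    true_and, Sigma.exists]
  grind

theorem sum_consWords {T : Matrix (Fin n) (Fin n) ℝ} {lam : ℝ} {v : Fin n → ℝ}
    (hT01 : ∀ i j, T i j = 0 ∨ T i j = 1) (hlam : lam ≠ 0) (hv : T.mulVec v = lam • v)
    (S : Finset (List (Fin n))) (m : ℕ) :
    ∑ u ∈ consWords T S m, wordValue v lam u = lam * freeMass T S v lam m := by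
  classical
  rw [consWords, Finset.sum_image, Finset.sum_sigma, freeMass, Finset.mul_sum]
  · exact Finset.sum_congr rfl fun w hw =>
      sum_wordValue_cons hT01 hlam hv (mem_freeWords.1 hw).2.1
  · rintro ⟨w, a⟩ - ⟨w', a'⟩ - h
    simp at h
    simp [h]

theorem freeWords_succ_subset (T : Matrix (Fin n) (Fin n) ℝ) (S : Finset (List (Fin n))) (m : ℕ) :
    freeWords T S (m + 1) ⊆ consWords T S m := by
  intro u hu
  obtain ⟨hl, ha, hf⟩ := mem_freeWords.1 hu
  cases u with
  | nil => simp at hl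
  | cons a w =>
    have hi : w <:+: a :: w := (List.suffix_cons a w).isInfix
    exact mem_consWords.2 ⟨a, w, mem_freeWords.2 ⟨by simpa using hl, ha.of_infix hi, hf.of_infix hi⟩,
      ha, rfl⟩

theorem exists_prefix_of_mem_consWords {T : Matrix (Fin n) (Fin n) ℝ}
    {S : Finset (List (Fin n))} {m : ℕ} {u : List (Fin n)} (hu : u ∈ consWords T S m)
    (hu' : u ∉ freeWords T S (m + 1)) (hS : ∀ τ ∈ S, τ ≠ []) :
    ∃ τ ∈ S, τ.length ≤ m + 1 ∧ ∃ ρ ∈ freeWords T S (m + 1 - τ.length), τ ++ ρ = u := by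
  obtain ⟨a, w, hw, ha, rfl⟩ := mem_consWords.1 hu
  obtain ⟨hl, hwa, hf⟩ := mem_freeWords.1 hw
  have : ¬ SFree S (a :: w) := fun h => hu' (mem_freeWords.2 ⟨by simp [hl], ha, h⟩)
  simp only [SFree, not_forall, not_not] at this
  obtain ⟨τ, hτ, hi⟩ := this
  rcases List.infix_cons_iff.1 hi with ⟨ρ, hρ⟩ | hi
  · have hlen : τ.length + ρ.length = m + 1 := by
      rw [← List.length_append, hρ]; simp [hl]
    refine ⟨τ, hτ, by omega, ρ, ?_, hρ⟩
    have hρw : ρ <:+: w := by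
      cases τ with
      | nil => exact absurd rfl (hS _ hτ)
      | cons b τ =>
        simp only [List.cons_append, List.cons.injEq] at hρ
        exact ⟨τ, [], by simp [hρ.2]⟩
    exact mem_freeWords.2 ⟨by omega, hwa.of_infix hρw, hf.of_infix hρw⟩
  · exact absurd hi (hf τ hτ)

theorem freeMass_succ_le {T : Matrix (Fin n) (Fin n) ℝ} {lam : ℝ} {v : Fin n → ℝ}
    (hT01 : ∀ i j, T i j = 0 ∨ T i j = 1) (hlam : lam ≠ 0) (hv : T.mulVec v = lam • v)
    (hpos : ∀ w, 0 ≤ wordValue v lam w) (S : Finset (List (Fin n))) (m : ℕ) :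
    freeMass T S v lam (m + 1) ≤ lam * freeMass T S v lam m := by
  rw [← sum_consWords hT01 hlam hv]
  exact Finset.sum_le_sum_of_subset_of_nonneg (freeWords_succ_subset T S m) fun w _ _ => hpos w

theorem mul_freeMass_le {T : Matrix (Fin n) (Fin n) ℝ} {lam : ℝ} {v : Fin n → ℝ}
    (hT01 : ∀ i j, T i j = 0 ∨ T i j = 1) (hlam : lam ≠ 0) (hv : T.mulVec v = lam • v)
    (hpos : ∀ w, 0 ≤ wordValue v lam w) {K : ℝ}
    (hK : ∀ w w', wordValue v lam w ≤ K * wordValue v lam w')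
    (S : Finset (List (Fin n))) (hS : ∀ τ ∈ S, τ ≠ []) (m : ℕ) :
    lam * freeMass T S v lam m ≤ freeMass T S v lam (m + 1) +
      K * ∑ τ ∈ S with τ.length ≤ m + 1, freeMass T S v lam (m + 1 - τ.length) := by
  classical
  rw [← sum_consWords hT01 hlam hv,
    ← Finset.sum_sdiff (freeWords_succ_subset T S m), add_comm, freeMass]
  gcongr
  set P := (S.filter fun τ => τ.length ≤ m + 1).sigma
    fun τ => freeWords T S (m + 1 - τ.length) with hP
  have hsub : consWords T S m \ freeWords T S (m + 1) ⊆ P.image fun x => x.1 ++ x.2 := by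
    intro u hu
    obtain ⟨hu1, hu2⟩ := Finset.mem_sdiff.1 hu
    obtain ⟨τ, hτ, hl, ρ, hρ, rfl⟩ := exists_prefix_of_mem_consWords hu1 hu2 hS
    exact Finset.mem_image.2 ⟨⟨τ, ρ⟩, by simp [hP, hτ, hl, hρ], rfl⟩
  calc _ ≤ ∑ u ∈ P.image fun x => x.1 ++ x.2, wordValue v lam u :=
        Finset.sum_le_sum_of_subset_of_nonneg hsub fun w _ _ => hpos w
    _ ≤ ∑ x ∈ P, wordValue v lam (x.1 ++ x.2) :=
        Finset.sum_image_le_of_nonneg fun w _ => hpos w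
    _ ≤ ∑ x ∈ P, K * wordValue v lam x.2 := Finset.sum_le_sum fun x _ => hK _ _
    _ = _ := by rw [← Finset.mul_sum, hP, Finset.sum_sigma]; rfl

/-- The words of length `m` occurring in elements of `X`. -/
def language {A : Type*} (X : Set (ℤ → A)) (m : ℕ) : Set (List A) :=
  {w | w.length = m ∧ ∃ x ∈ X, Occurs w x}

theorem language_finite {A : Type*} [Finite A] (X : Set (ℤ → A)) (m : ℕ) :
    (language X m).Finite :=
  (List.finite_length_eq A m).subset fun _ hw => hw.1

/-- The transition at `a` is allowed and no word of `S` occurs at `a`. -/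
def GoodAt (T : Matrix (Fin n) (Fin n) ℝ) (S : Finset (List (Fin n))) (x : ℤ → Fin n) (a : ℤ) :
    Prop :=
  T (x (a + 1)) (x a) = 1 ∧ ∀ τ ∈ S, ¬ OccursAt τ x a

theorem mem_avoid_iff {T : Matrix (Fin n) (Fin n) ℝ} {S : Finset (List (Fin n))}
    {x : ℤ → Fin n} : x ∈ Avoid T S ↔ ∀ a, GoodAt T S x a := by
  simp only [Avoid, SFTspace, Occurs, GoodAt, Set.mem_ofPred_eq, forall_and]
  grind

theorem isOpen_setOf_occursAt {A : Type*} [TopologicalSpace A] [DiscreteTopology A]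
    (w : List A) (a : ℤ) : IsOpen {x : ℤ → A | OccursAt w x a} := by
  have : {x : ℤ → A | OccursAt w x a} =
      ⋂ j : Fin w.length, {x | x (a + (j : ℕ)) = w.get j} := by
    ext x
    simp only [OccursAt, Set.mem_ofPred_eq, Set.mem_iInter]
    exact ⟨fun h j => h j j.2, fun h j hj => h ⟨j, hj⟩⟩
  rw [this]
  exact isOpen_iInter_of_finite fun j =>
    (isOpen_discrete {w.get j}).preimage (continuous_apply (A := fun _ => A) (a + (j : ℕ)))

theorem isClosed_setOf_goodAt (T : Matrix (Fin n) (Fin n) ℝ) (S : Finset (List (Fin n)))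
    (a : ℤ) : IsClosed {x | GoodAt T S x a} := by
  have h1 : IsClosed {x : ℤ → Fin n | T (x (a + 1)) (x a) = 1} :=
    (isClosed_discrete {p : Fin n × Fin n | T p.1 p.2 = 1}).preimage
      (f := fun x : ℤ → Fin n => (x (a + 1), x a)) (by fun_prop)
  have h2 : IsClosed {x : ℤ → Fin n | ∀ τ ∈ S, ¬ OccursAt τ x a} := by
    simp only [Set.ofPred_forall]
    exact isClosed_biInter fun τ _ => (isOpen_setOf_occursAt τ a).isClosed_compl
  exact h1.inter h2

theorem occursAt_ofFn {A : Type*} (x : ℤ → A) (m : ℕ) :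
    OccursAt (List.ofFn fun i : Fin m => x (i : ℕ)) x 0 := by
  intro j hj
  simp

/-- By compactness, a word occurs in the subshift as soon as a sequence containing it is good at
all coordinates near the origin. -/
theorem exists_window (T : Matrix (Fin n) (Fin n) ℝ) (S : Finset (List (Fin n))) (m : ℕ) :
    ∃ M : ℕ, ∀ x : ℤ → Fin n, (∀ a : ℤ, -M ≤ a → a ≤ M → GoodAt T S x a) →
      (List.ofFn fun i : Fin m => x (i : ℕ)) ∈ language (Avoid T S) m := by
  by_contra! hne
  let B : Set (ℤ → Fin n) :=
    {x | (List.ofFn fun i : Fin m => x (i : ℕ)) ∉ language (Avoid T S) m}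
  let F : ℕ → Set (ℤ → Fin n) := fun M =>
    (⋂ a : ℤ, ⋂ (_ : -M ≤ a), ⋂ (_ : a ≤ M), {x | GoodAt T S x a}) ∩ B
  have hB : IsClosed B :=
    (isClosed_discrete {f : Fin m → Fin n | List.ofFn f ∉ language (Avoid T S) m}).preimage
      (f := fun (x : ℤ → Fin n) (i : Fin m) => x (i : ℕ)) (by fun_prop)
  have hF : ∀ M, IsClosed (F M) := fun M =>
    (isClosed_iInter fun a => isClosed_iInter fun _ => isClosed_iInter fun _ =>
      isClosed_setOf_goodAt T S a).inter hB
  obtain ⟨x, hx⟩ := IsCompact.nonempty_iInter_of_sequence_nonempty_isCompact_isClosed F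
    (fun M x hx => by
      simp only [F, Set.mem_inter_iff, Set.mem_iInter, Set.mem_ofPred_eq] at hx ⊢
      exact ⟨fun a h1 h2 => hx.1 a (by push_cast; omega) (by push_cast; omega), hx.2⟩)
    (fun M => by
      obtain ⟨x, hx, hx'⟩ := hne M
      exact ⟨x, by simpa only [F, Set.mem_inter_iff, Set.mem_iInter, Set.mem_ofPred_eq] using
        ⟨hx, hx'⟩⟩)
    (hF 0).isCompact hF
  simp only [F, Set.mem_inter_iff, Set.mem_iInter, Set.mem_ofPred_eq] at hx
  refine (hx 0).2 ⟨by simp, x, mem_avoid_iff.2 fun a => ?_, 0, occursAt_ofFn x m⟩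
  exact (hx a.natAbs).1 a (by omega) (by omega)

/-- A word with a long admissible `S`-free extension on both sides occurs in the subshift. -/
theorem exists_margin [NeZero n] (T : Matrix (Fin n) (Fin n) ℝ) (S : Finset (List (Fin n)))
    (m : ℕ) :
    ∃ M : ℕ, ∀ p w s : List (Fin n), M ≤ p.length → M ≤ s.length → w.length = m →
      Admissible T (p ++ w ++ s) → SFree S (p ++ w ++ s) → w ∈ language (Avoid T S) m := by
  obtain ⟨M, hM⟩ := exists_window T S m
  refine ⟨M + 2 + S.sup List.length, fun p w s hp hs hw ha hf => ?_⟩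
  set u := p ++ w ++ s with hu
  have hul : u.length = p.length + m + s.length := by simp [hu, hw]; ring
  let x : ℤ → Fin n := fun i => u.getD (i + p.length).toNat 0
  have key : ∀ (a : ℤ) (j : ℕ), -M ≤ a → a ≤ M → j ≤ 1 + S.sup List.length →
      ∃ h : (a + p.length).toNat + j < u.length, x (a + j) = u[(a + p.length).toNat + j] := by
    intro a j h1 h2 h3
    have e : (a + j + p.length).toNat = (a + p.length).toNat + j := by omega
    have h : (a + p.length).toNat + j < u.length := by omega
    refine ⟨h, ?_⟩
    simp only [x, e]
    exact List.getD_eq_getElem _ _ h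
  have hw' : (List.ofFn fun i : Fin m => x (i : ℕ)) = w := by
    refine List.ext_getElem (by simp [hw]) fun i h1 h2 => ?_
    have e : ((i : ℤ) + p.length).toNat = p.length + i := by omega
    simp only [List.getElem_ofFn, x, e]
    rw [List.getD_eq_getElem _ _ (by omega)]
    simp only [hu, List.append_assoc]
    rw [List.getElem_append_right (by omega), List.getElem_append_left (by omega)]
    simp
  rw [← hw']
  refine hM x fun a h1 h2 => ⟨?_, fun τ hτ hocc => ?_⟩
  · obtain ⟨i0, e0⟩ := key a 0 h1 h2 (by omega)
    obtain ⟨i1, e1⟩ := key a 1 h1 h2 (by omega)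
    simp only [Nat.cast_zero, add_zero, Nat.cast_one] at e0 e1
    rw [e0, e1]
    exact List.isChain_iff_getElem.1 (admissible_iff.1 ha) _ i1
  · have hl : τ.length ≤ S.sup List.length := Finset.le_sup (f := List.length) hτ
    have : τ = (u.drop (a + p.length).toNat).take τ.length := by
      refine List.ext_getElem ?_ fun j hj hj' => ?_
      · obtain ⟨h, -⟩ := key a (τ.length) h1 h2 (by omega)
        simp; omega
      · obtain ⟨h, e⟩ := key a j h1 h2 (by omega)
        have := hocc j hj
        simp only [List.getElem_take, List.getElem_drop]
        rw [← e, this]; rfl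
    refine hf τ hτ ?_
    rw [this]
    exact (List.take_prefix _ _).isInfix.trans (List.drop_suffix _ _).isInfix

open Classical in
/-- Words of length `l` with an admissible `S`-free extension by at least `M` letters on each
side. -/
noncomputable def extendableWords (T : Matrix (Fin n) (Fin n) ℝ) (S : Finset (List (Fin n)))
    (M l : ℕ) : Finset (List (Fin n)) :=
  (List.finite_length_eq (Fin n) l).toFinset.filter fun w => ∃ p s : List (Fin n),
    M ≤ p.length ∧ M ≤ s.length ∧ Admissible T (p ++ w ++ s) ∧ SFree S (p ++ w ++ s)

theorem mem_extendableWords {T : Matrix (Fin n) (Fin n) ℝ} {S : Finset (List (Fin n))}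
    {M l : ℕ} {w : List (Fin n)} :
    w ∈ extendableWords T S M l ↔ w.length = l ∧ ∃ p s : List (Fin n),
      M ≤ p.length ∧ M ≤ s.length ∧ Admissible T (p ++ w ++ s) ∧ SFree S (p ++ w ++ s) := by
  simp [extendableWords]

theorem card_extendableWords_add (T : Matrix (Fin n) (Fin n) ℝ) (S : Finset (List (Fin n)))
    (M l l' : ℕ) :
    (extendableWords T S M (l + l')).card ≤
      (extendableWords T S M l).card * (extendableWords T S M l').card := by
  rw [← Finset.card_product]
  refine Finset.card_le_card_of_injOn (fun w => (w.take l, w.drop l)) (fun w hw => ?_) ?_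
  · obtain ⟨hl, p, s, hp, hs, ha, hf⟩ := mem_extendableWords.1 (Finset.mem_coe.1 hw)
    have e1 : p ++ w.take l ++ (w.drop l ++ s) = p ++ w ++ s := by
      simp only [List.append_assoc]
      rw [← List.append_assoc (w.take l), List.take_append_drop]
    have e2 : (p ++ w.take l) ++ w.drop l ++ s = p ++ w ++ s := by
      rw [List.append_assoc p, List.take_append_drop]
    refine Finset.mem_coe.2 (Finset.mem_product.2
      ⟨mem_extendableWords.2 ⟨by simp [hl], p, w.drop l ++ s, hp, ?_, ?_⟩,
        mem_extendableWords.2 ⟨by simp [hl], p ++ w.take l, s, ?_, hs, ?_⟩⟩)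
    · simp; omega
    · rw [e1]; exact ⟨ha, hf⟩
    · simp; omega
    · rw [e2]; exact ⟨ha, hf⟩
  · intro w _ w' _ h
    simp only [Prod.mk.injEq] at h
    rw [← List.take_append_drop l w, h.1, h.2, List.take_append_drop]

theorem card_extendableWords_mul (T : Matrix (Fin n) (Fin n) ℝ) (S : Finset (List (Fin n)))
    (M m j : ℕ) :
    (extendableWords T S M (j * m)).card ≤ (extendableWords T S M m).card ^ j := by
  induction j with
  | zero =>
    simp only [zero_mul, pow_zero]
    refine Finset.card_le_one.2 fun a ha b hb => ?_
    rw [List.length_eq_zero_iff.1 (mem_extendableWords.1 ha).1,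
      List.length_eq_zero_iff.1 (mem_extendableWords.1 hb).1]
  | succ j ih =>
    rw [Nat.succ_mul, pow_succ]
    exact (card_extendableWords_add ..).trans (Nat.mul_le_mul_right _ ih)

theorem card_freeWords_le (T : Matrix (Fin n) (Fin n) ℝ) (S : Finset (List (Fin n)))
    (M l : ℕ) :
    (freeWords T S (M + l + M)).card ≤
      (List.finite_length_eq (Fin n) M).toFinset.card ^ 2 * (extendableWords T S M l).card := by
  rw [sq, mul_assoc, ← Finset.card_product, ← Finset.card_product]
  refine Finset.card_le_card_of_injOn
    (fun w => (w.take M, (w.drop M).drop l, (w.drop M).take l)) (fun w hw => ?_) ?_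
  · obtain ⟨hl, ha, hf⟩ := mem_freeWords.1 (Finset.mem_coe.1 hw)
    have e : w.take M ++ (w.drop M).take l ++ (w.drop M).drop l = w := by
      rw [List.append_assoc, List.take_append_drop, List.take_append_drop]
    simp only [Finset.coe_product, Set.mem_prod, Finset.mem_coe, Set.Finite.mem_toFinset,
      Set.mem_ofPred_eq, mem_extendableWords]
    refine ⟨by simp; omega, by simp; omega, by simp; omega, w.take M, (w.drop M).drop l,
      by simp; omega, by simp; omega, ?_⟩
    rw [e]
    exact ⟨ha, hf⟩
  · intro w _ w' _ h
    simp only [Prod.mk.injEq] at h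
    rw [← List.take_append_drop M w, ← List.take_append_drop l (w.drop M), h.1, h.2.1, h.2.2,
      List.take_append_drop, List.take_append_drop]

theorem pow_le_wordCount_avoid [NeZero n] (T : Matrix (Fin n) (Fin n) ℝ)
    (S : Finset (List (Fin n))) {c x : ℝ} (hc : 0 < c) (hx : 0 < x)
    (h : ∀ m, c * x ^ m ≤ (freeWords T S m).card) (m : ℕ) :
    x ^ m ≤ wordCount (Avoid T S) m := by
  obtain ⟨M, hM⟩ := exists_margin T S m
  have hsub : (extendableWords T S M m).card ≤ wordCount (Avoid T S) m := by
    rw [← Set.ncard_coe_finset]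
    refine Set.ncard_le_ncard (fun w hw => ?_) (language_finite (Avoid T S) m)
    obtain ⟨hl, p, s, hp, hs, ha, hf⟩ := mem_extendableWords.1 (Finset.mem_coe.1 hw)
    exact hM p w s hp hs hl ha hf
  refine le_of_forall_mul_pow_le (c := c * x ^ (2 * M))
    (D := ((List.finite_length_eq (Fin n) M).toFinset.card ^ 2 : ℕ)) (by positivity)
    (by positivity) (by positivity) fun j => ?_
  calc c * x ^ (2 * M) * (x ^ m) ^ j = c * x ^ (M + j * m + M) := by
        rw [← pow_mul, mul_assoc, ← pow_add]; congr 2; ring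
    _ ≤ (freeWords T S (M + j * m + M)).card := h _
    _ ≤ _ := by
        have h1 := (card_freeWords_le T S M (j * m)).trans (Nat.mul_le_mul_left _
          ((card_extendableWords_mul T S M m j).trans (Nat.pow_le_pow_left hsub j)))
        exact_mod_cast h1

theorem admissible_of_occursAt {T : Matrix (Fin n) (Fin n) ℝ} {x : ℤ → Fin n}
    (hx : x ∈ SFTspace T) {w : List (Fin n)} {a : ℤ} (h : OccursAt w x a) : Admissible T w := by
  refine admissible_iff.2 (List.isChain_iff_getElem.2 fun i hi => ?_)
  have h0 := h i (by omega)
  have h1 := h (i + 1) hi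
  have h2 := hx (a + i)
  simp only [List.get_eq_getElem] at h0 h1
  rw [← h0, ← h1]
  push_cast
  rwa [← add_assoc]

theorem wordCount_le_card_freeWords {T : Matrix (Fin n) (Fin n) ℝ} {X : Set (ℤ → Fin n)}
    (hX : X ⊆ SFTspace T) (m : ℕ) : wordCount X m ≤ (freeWords T ∅ m).card := by
  rw [← Set.ncard_coe_finset]
  refine Set.ncard_le_ncard (fun w hw => ?_) (Finset.finite_toSet _)
  obtain ⟨hl, x, hx, a, ha⟩ := hw
  exact Finset.mem_coe.2 (mem_freeWords.2 ⟨hl, admissible_of_occursAt (hX hx) ha, by simp [SFree]⟩)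

theorem freeWords_zero {T : Matrix (Fin n) (Fin n) ℝ} {S : Finset (List (Fin n))}
    (hS : ∀ τ ∈ S, τ ≠ []) : freeWords T S 0 = {[]} := by
  ext w
  simp only [mem_freeWords, List.length_eq_zero_iff, Finset.mem_singleton, and_iff_left_iff_imp]
  rintro rfl
  exact ⟨admissible_iff.2 List.isChain_nil, fun τ hτ h => hS τ hτ (List.infix_nil.1 h)⟩

theorem wordValue_pos [NeZero n] {v : Fin n → ℝ} (hv : ∀ i, 0 < v i) {lam : ℝ} (hlam : 0 < lam)
    (w : List (Fin n)) : 0 < wordValue v lam w := by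
  cases w with
  | nil => exact div_pos (Finset.sum_pos (fun i _ => hv i) Finset.univ_nonempty) hlam
  | cons a w => exact hv a

theorem exists_wordValue_le_mul [NeZero n] {v : Fin n → ℝ} (hv : ∀ i, 0 < v i) {lam : ℝ}
    (hlam : 0 < lam) :
    ∃ K : ℝ, 0 < K ∧ ∀ w w', wordValue v lam w ≤ K * wordValue v lam w' := by
  have hfin : (Set.range (wordValue v lam)).Finite := by
    refine ((Set.finite_range v).insert ((∑ a, v a) / lam)).subset ?_
    rintro _ ⟨_ | ⟨a, w⟩, rfl⟩
    · exact Set.mem_insert _ _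
    · exact Set.mem_insert_of_mem _ ⟨a, rfl⟩
  obtain ⟨_, ⟨u, rfl⟩, hu⟩ := Set.exists_min_image _ id hfin (Set.range_nonempty _)
  obtain ⟨_, ⟨u', rfl⟩, hu'⟩ := Set.exists_max_image _ id hfin (Set.range_nonempty _)
  have h1 := wordValue_pos hv hlam u
  have h2 := wordValue_pos hv hlam u'
  refine ⟨wordValue v lam u' / wordValue v lam u, div_pos h2 h1, fun w w' => ?_⟩
  have h3 : wordValue v lam w ≤ wordValue v lam u' := hu' _ ⟨w, rfl⟩
  have h4 : wordValue v lam u ≤ wordValue v lam w' := hu _ ⟨w', rfl⟩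
  rw [div_mul_eq_mul_div, le_div_iff₀ h1]
  gcongr

/-- The value of the `S`-free words of length `m`, relative to that of all words. -/
noncomputable def freeRatio (T : Matrix (Fin n) (Fin n) ℝ) (S : Finset (List (Fin n)))
    (v : Fin n → ℝ) (lam : ℝ) (m : ℕ) : ℝ :=
  freeMass T S v lam m / (lam ^ m * wordValue v lam [])

section

variable [NeZero n] {T : Matrix (Fin n) (Fin n) ℝ} {S : Finset (List (Fin n))} {v : Fin n → ℝ}
  {lam K : ℝ}

theorem freeRatio_nonneg (hv : ∀ i, 0 < v i) (hlam : 0 < lam) (m : ℕ) :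
    0 ≤ freeRatio T S v lam m := by
  have := wordValue_pos hv hlam []
  exact div_nonneg (Finset.sum_nonneg fun w _ => (wordValue_pos hv hlam w).le) (by positivity)

theorem freeRatio_zero (hv : ∀ i, 0 < v i) (hlam : 0 < lam) (hS : ∀ τ ∈ S, τ ≠ []) :
    freeRatio T S v lam 0 = 1 := by
  have := wordValue_pos hv hlam []
  simp [freeRatio, freeMass, freeWords_zero hS, this.ne']

theorem freeRatio_antitone (hT01 : ∀ i j, T i j = 0 ∨ T i j = 1) (hv : ∀ i, 0 < v i)
    (hlam : 0 < lam) (hTv : T.mulVec v = lam • v) : Antitone (freeRatio T S v lam) := by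
  refine antitone_nat_of_succ_le fun m => ?_
  have h0 := wordValue_pos hv hlam []
  have h := freeMass_succ_le hT01 hlam.ne' hTv (fun w => (wordValue_pos hv hlam w).le) S m
  rw [freeRatio, freeRatio, div_le_div_iff₀ (by positivity) (by positivity)]
  calc _ ≤ lam * freeMass T S v lam m * (lam ^ m * wordValue v lam []) := by gcongr
    _ = _ := by ring

theorem freeRatio_sub_le (hT01 : ∀ i j, T i j = 0 ∨ T i j = 1) (hv : ∀ i, 0 < v i)
    (hlam : 0 < lam) (hTv : T.mulVec v = lam • v)
    (hK : ∀ w w', wordValue v lam w ≤ K * wordValue v lam w') (hS : ∀ τ ∈ S, τ ≠ []) (m : ℕ) :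
    freeRatio T S v lam m - freeRatio T S v lam (m + 1) ≤
      K * ∑ τ ∈ S with τ.length ≤ m + 1,
        (lam⁻¹) ^ τ.length * freeRatio T S v lam (m + 1 - τ.length) := by
  have h0 := wordValue_pos hv hlam []
  have h := mul_freeMass_le hT01 hlam.ne' hTv (fun w => (wordValue_pos hv hlam w).le) hK S hS m
  have e1 : freeRatio T S v lam m =
      lam * freeMass T S v lam m / (lam ^ (m + 1) * wordValue v lam []) := by
    rw [freeRatio, pow_succ]; field_simp
  have e2 : ∑ τ ∈ S with τ.length ≤ m + 1,
        (lam⁻¹) ^ τ.length * freeRatio T S v lam (m + 1 - τ.length) =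
      (∑ τ ∈ S with τ.length ≤ m + 1, freeMass T S v lam (m + 1 - τ.length)) /
        (lam ^ (m + 1) * wordValue v lam []) := by
    rw [Finset.sum_div]
    refine Finset.sum_congr rfl fun τ hτ => ?_
    have e3 : lam ^ (m + 1) = lam ^ τ.length * lam ^ (m + 1 - τ.length) := by
      rw [← pow_add, Nat.add_sub_cancel' (Finset.mem_filter.1 hτ).2]
    rw [freeRatio, e3, inv_pow]
    field_simp
  rw [e1, e2, freeRatio, ← sub_div, mul_div_assoc']
  gcongr
  linarith

theorem freeRatio_mul_le_card (hv : ∀ i, 0 < v i) (hlam : 0 < lam)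
    (hK : ∀ w w', wordValue v lam w ≤ K * wordValue v lam w') (m : ℕ) :
    freeRatio T S v lam m * lam ^ m ≤ K * (freeWords T S m).card := by
  have h0 := wordValue_pos hv hlam []
  have h : freeMass T S v lam m ≤ (freeWords T S m).card • (K * wordValue v lam []) :=
    Finset.sum_le_card_nsmul _ _ _ fun w _ => hK w []
  rw [nsmul_eq_mul] at h
  rw [freeRatio, ← div_div, div_mul_eq_mul_div, div_mul_cancel₀ _ (by positivity), div_le_iff₀ h0]
  linarith

theorem card_le_freeRatio_mul (hv : ∀ i, 0 < v i) (hlam : 0 < lam)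
    (hK : ∀ w w', wordValue v lam w ≤ K * wordValue v lam w') (m : ℕ) :
    (freeWords T S m).card ≤ K * freeRatio T S v lam m * lam ^ m := by
  have h0 := wordValue_pos hv hlam []
  have h : (freeWords T S m).card • wordValue v lam [] ≤
      ∑ w ∈ freeWords T S m, K * wordValue v lam w :=
    Finset.card_nsmul_le_sum _ _ _ fun w _ => hK [] w
  rw [nsmul_eq_mul, ← Finset.mul_sum, ← freeMass] at h
  rw [freeRatio, mul_div_assoc', div_mul_eq_mul_div, le_div_iff₀ (by positivity)]
  nlinarith [pow_pos hlam m]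

theorem wordCount_le_mul_pow (hT01 : ∀ i j, T i j = 0 ∨ T i j = 1) (hv : ∀ i, 0 < v i)
    (hlam : 0 < lam) (hTv : T.mulVec v = lam • v) (hK0 : 0 < K)
    (hK : ∀ w w', wordValue v lam w ≤ K * wordValue v lam w') {X : Set (ℤ → Fin n)}
    (hX : X ⊆ SFTspace T) (m : ℕ) : wordCount X m ≤ K * lam ^ m := by
  have h1 : freeRatio T ∅ v lam m ≤ 1 := by
    rw [← freeRatio_zero (T := T) hv hlam (S := ∅) (by simp)]
    exact freeRatio_antitone hT01 hv hlam hTv (Nat.zero_le m)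
  calc (wordCount X m : ℝ) ≤ (freeWords T ∅ m).card := by
        exact_mod_cast wordCount_le_card_freeWords hX m
    _ ≤ K * freeRatio T ∅ v lam m * lam ^ m := card_le_freeRatio_mul hv hlam hK m
    _ ≤ K * 1 * lam ^ m := by gcongr
    _ = _ := by ring

end

end

theorem log_wordCount_div_le {A : Type*} {X : Set (ℤ → A)} {K lam : ℝ} (hK : 1 ≤ K)
    (hlam : 1 ≤ lam) (h : ∀ m, wordCount X m ≤ K * lam ^ m) {m : ℕ} (hm : 0 < m) :
    Real.log (wordCount X m) / m ≤ Real.log lam + Real.log K / m := by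
  have hm' : (0 : ℝ) < m := by exact_mod_cast hm
  rw [div_le_iff₀ hm', add_mul, div_mul_cancel₀ _ hm'.ne']
  rcases Nat.eq_zero_or_pos (wordCount X m) with h0 | h0
  · have := Real.log_nonneg hK
    have := Real.log_nonneg hlam
    rw [h0, Nat.cast_zero, Real.log_zero]
    positivity
  · calc Real.log (wordCount X m) ≤ Real.log (K * lam ^ m) :=
          Real.log_le_log (by exact_mod_cast h0) (h m)
      _ = _ := by
          rw [Real.log_mul (by positivity) (by positivity), Real.log_pow]; ring

theorem tendsto_const_add_div_atTop (c d : ℝ) :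
    Tendsto (fun m : ℕ => c + d / m) atTop (nhds c) := by
  simpa using (tendsto_const_div_atTop_nhds_zero_nat d).const_add c

theorem entropy_le_log {A : Type*} {X : Set (ℤ → A)} {K lam : ℝ} (hK : 1 ≤ K)
    (hlam : 1 ≤ lam) (h : ∀ m, wordCount X m ≤ K * lam ^ m) : entropy X ≤ Real.log lam := by
  have ht := tendsto_const_add_div_atTop (Real.log lam) (Real.log K)
  rw [entropy, ← ht.limsup_eq]
  refine limsup_le_limsup ?_ ?_ ht.isBoundedUnder_le
  · filter_upwards [eventually_gt_atTop 0] with m hm using log_wordCount_div_le hK hlam h hm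
  · exact (isBoundedUnder_of ⟨0, fun m => by positivity⟩ :
      IsBoundedUnder (· ≥ ·) atTop fun m : ℕ => Real.log (wordCount X m) / m).isCoboundedUnder_le

theorem log_le_entropy {A : Type*} {X : Set (ℤ → A)} {K lam x : ℝ} (hK : 1 ≤ K)
    (hlam : 1 ≤ lam) (h : ∀ m, wordCount X m ≤ K * lam ^ m) (hx : 0 < x)
    (h' : ∀ m, x ^ m ≤ wordCount X m) : Real.log x ≤ entropy X := by
  have ht := tendsto_const_add_div_atTop (Real.log lam) (Real.log K)
  refine le_limsup_of_frequently_le (Eventually.frequently ?_) ?_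
  · filter_upwards [eventually_gt_atTop 0] with m hm
    rw [le_div_iff₀ (by exact_mod_cast hm), mul_comm, ← Real.log_pow]
    exact Real.log_le_log (by positivity) (h' m)
  · refine ht.isBoundedUnder_le.mono_le ?_
    filter_upwards [eventually_gt_atTop 0] with m hm using log_wordCount_div_le hK hlam h hm

theorem entropy_of_isEmpty {A : Type*} [IsEmpty A] (X : Set (ℤ → A)) : entropy X = 0 := by
  have : X = ∅ := Set.eq_empty_of_isEmpty X
  simp [entropy, wordCount, this]

/-- **Theorem 1 (main).** There is a constant `C > 0` depending only on `Σ` such that: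
if `k ≥ 1`, every element of `S` has length at least `k`, and there is
`t ∈ (1, λ^k)` with `r = (1 + k·C·λ^{2k}·p(t^{1/k}/λ))/t < 1`, then
`h(Σ) - h(Σ⟨S⟩) ≤ -log(1 - r)/k`. -/
theorem main_entropy_bound
    {n : ℕ} (T : Matrix (Fin n) (Fin n) ℝ) (lam : ℝ)
    (hT01 : ∀ i j, T i j = 0 ∨ T i j = 1)
    (hirr : ∀ i j : Fin n, ∃ m : ℕ, 0 < m ∧ 0 < (T ^ m) i j)
    (hlam : 1 < lam)
    (hPerron : ∃ v : Fin n → ℝ, (∀ i, 0 < v i) ∧ T.mulVec v = lam • v) :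
    ∃ C : ℝ, 0 < C ∧
      ∀ S : Finset (List (Fin n)),
        (∀ τ ∈ S, τ ≠ []) → (∀ τ ∈ S, Admissible T τ) →
        (∀ τ ∈ S, ∀ τ' ∈ S, τ ≠ τ' → ¬ τ <:+: τ') →
        ∀ k : ℕ, 1 ≤ k → (∀ τ ∈ S, k ≤ τ.length) →
        ∀ t : ℝ, 1 < t → t < lam ^ k →
        (1 + k * C * lam ^ (2 * k) * wordPoly S (t ^ ((1 : ℝ) / k) / lam)) / t < 1 →
        entropy (SFTspace T) - entropy (Avoid T S) ≤
          -Real.log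
              (1 - (1 + k * C * lam ^ (2 * k) * wordPoly S (t ^ ((1 : ℝ) / k) / lam)) / t)
            / k := by
  rcases Nat.eq_zero_or_pos n with rfl | hn
  · refine ⟨1, one_pos, fun S hS _ _ k hk _ t ht _ hr => ?_⟩
    rw [entropy_of_isEmpty, entropy_of_isEmpty, sub_zero]
    have hP : 0 ≤ wordPoly S (t ^ ((1 : ℝ) / k) / lam) :=
      Finset.sum_nonneg fun τ _ => by positivity
    refine div_nonneg (neg_nonneg.2 (Real.log_nonpos (by linarith) ?_)) (by positivity)
    rw [sub_le_self_iff]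
    positivity
  have : NeZero n := ⟨hn.ne'⟩
  obtain ⟨v, hv, hTv⟩ := hPerron
  have hlam0 : 0 < lam := by linarith
  obtain ⟨K, hK0, hK⟩ := exists_wordValue_le_mul hv hlam0
  have hK1 : 1 ≤ K := by
    have := hK [] []
    rwa [le_mul_iff_one_le_left (wordValue_pos hv hlam0 [])] at this
  refine ⟨K, hK0, fun S hS _ _ k hk hlen t ht htlam hr => ?_⟩
  set s := t ^ ((1 : ℝ) / k) with hs
  have hst : s ^ k = t := by
    rw [hs, one_div, Real.rpow_inv_natCast_pow (by linarith) (by omega)]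
  have hs1 : 1 ≤ s := Real.one_le_rpow ht.le (by positivity)
  have hP : 0 ≤ wordPoly S (s / lam) := Finset.sum_nonneg fun τ _ => by positivity
  set r := (1 + k * K * lam ^ (2 * k) * wordPoly S (s / lam)) / t with hrdef
  have hr0 : 0 ≤ r := by positivity
  have hloss : k * K * t * wordPoly S (s / lam) ≤ r - 1 / t := by
    have e : r - 1 / t = k * K * lam ^ (2 * k) * wordPoly S (s / lam) / t := by
      rw [hrdef]; ring
    rw [e, le_div_iff₀ (by linarith)]
    calc k * K * t * wordPoly S (s / lam) * t = k * K * t ^ 2 * wordPoly S (s / lam) := by ring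
      _ ≤ k * K * (lam ^ k) ^ 2 * wordPoly S (s / lam) := by gcongr
      _ = _ := by rw [← pow_mul, mul_comm k 2]
  have hanti : Antitone (freeRatio T S v lam) := freeRatio_antitone hT01 hv hlam0 hTv
  have hnonneg : ∀ m, 0 ≤ freeRatio T S v lam m := freeRatio_nonneg hv hlam0
  have hcontr : ∀ m, (1 - r) * freeRatio T S v lam m ≤ freeRatio T S v lam (m + k) := fun m => by
    refine le_trans (mul_le_mul_of_nonneg_right ?_ (hnonneg m))
      (sub_le_of_recurrence S List.length _ hnonneg hanti hK0.le hlam0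
        (freeRatio_sub_le hT01 hv hlam0 hTv hK hS) hlen hs1 hst hk ?_ m)
    · have : 0 < 1 / t := by positivity
      change _ ≤ 1 - k * K * t * wordPoly S (s / lam)
      linarith
    · change _ ≤ 1 - k * K * t * wordPoly S (s / lam)
      linarith
  have hq : 0 < 1 - r := by linarith
  set θ := (1 - r) ^ ((1 : ℝ) / k) with hθ
  have hθ0 : 0 < θ := Real.rpow_pos_of_pos hq _
  have hθ1 : θ ≤ 1 := Real.rpow_le_one hq.le (by linarith) (by positivity)
  have hθk : θ ^ k = 1 - r := by
    rw [hθ, one_div, Real.rpow_inv_natCast_pow hq.le (by omega)]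
  have hcount : ∀ m, (1 - r) / K * (lam * θ) ^ m ≤ (freeWords T S m).card := fun m => by
    have h1 := mul_pow_le_of_block_contraction _ hanti (hnonneg 0) hθ0 hθ1 hk
      (by rwa [hθk]) m
    rw [freeRatio_zero hv hlam0 hS, mul_one, hθk] at h1
    have h2 := freeRatio_mul_le_card (T := T) (S := S) hv hlam0 hK m
    rw [div_mul_eq_mul_div, div_le_iff₀ hK0]
    calc (1 - r) * (lam * θ) ^ m = (1 - r) * θ ^ m * lam ^ m := by rw [mul_pow]; ring
      _ ≤ freeRatio T S v lam m * lam ^ m := by gcongr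
      _ ≤ _ := by linarith
  have hupper : ∀ X ⊆ SFTspace T, ∀ m, (wordCount X m : ℝ) ≤ K * lam ^ m := fun X hX =>
    wordCount_le_mul_pow hT01 hv hlam0 hTv hK0 hK hX
  have hSFT : entropy (SFTspace T) ≤ Real.log lam :=
    entropy_le_log hK1 hlam.le (hupper _ subset_rfl)
  have hA : Real.log (lam * θ) ≤ entropy (Avoid T S) :=
    log_le_entropy hK1 hlam.le (hupper _ fun x hx => hx.1) (by positivity)
      (pow_le_wordCount_avoid T S (by positivity) (by positivity) hcount)
  rw [Real.log_mul hlam0.ne' hθ0.ne', hθ, Real.log_rpow hq] at hA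
  rw [neg_div]
  linarith [one_div_mul_eq_div (k : ℝ) (Real.log (1 - r))]

end SFT
end

section
/- Fix t > 0. If the admissible word σ does not end in an element of S, then (1/μ([σ]))·Σ_i μ([σi])·w(σi) = (w(σ) + p_σ)/t, where the sum is over all symbols i of the alphabet. -/
open Filter MeasureTheory
open scoped BigOperators

namespace SFT

section Measurability

variable {n : ℕ}

theorem measurableSet_setOf_occursAt (w : List (Fin n)) (a : ℤ) :
    MeasurableSet {x : ℤ → Fin n | OccursAt w x a} := by
  simp only [OccursAt, Set.ofPred_forall]
  exact .iInter fun j => .iInter fun h =>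
    measurableSet_eq_fun (measurable_pi_apply (a + j)) measurable_const

theorem measurableSet_SFTspace (T : Matrix (Fin n) (Fin n) ℝ) :
    MeasurableSet (SFTspace T) := by
  simp only [SFTspace, Set.ofPred_forall]
  refine .iInter fun i => ?_
  have h : Measurable fun x : ℤ → Fin n => T (x (i + 1)) (x i) :=
    (measurable_of_countable fun p : Fin n × Fin n => T p.1 p.2).comp
      ((measurable_pi_apply (X := fun _ : ℤ => Fin n) (i + 1)).prodMk (measurable_pi_apply i))
  exact measurableSet_eq_fun h measurable_const

theorem measurableSet_cylinder (T : Matrix (Fin n) (Fin n) ℝ) (σ : List (Fin n)) :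
    MeasurableSet (cylinder T σ) :=
  (measurableSet_SFTspace T).inter (measurableSet_setOf_occursAt σ 0)

theorem integrable_fword (μ : Measure (ℤ → Fin n)) [IsFiniteMeasure μ]
    (S : Finset (List (Fin n))) (t : ℝ) (σ : List (Fin n)) :
    Integrable (fword S t σ) μ := by
  unfold fword
  refine integrable_finsetSum _ fun τ _ => integrable_finsetSum _ fun j _ => ?_
  classical
  have hs : MeasurableSet {x : ℤ → Fin n | τ.length ≤ σ.length + j ∧
      OccursAt τ x ((σ.length : ℤ) + j - τ.length)} :=
    (MeasurableSet.const _).inter (measurableSet_setOf_occursAt τ _)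
  refine ((integrable_const (μ := μ) (t ^ j)).indicator hs).congr (.of_forall fun x => ?_)
  simp [Set.indicator_apply]

end Measurability

section Words

variable {A : Type*}

theorem occursAt_append (w w' : List A) (x : ℤ → A) (a : ℤ) :
    OccursAt (w ++ w') x a ↔ OccursAt w x a ∧ OccursAt w' x (a + w.length) := by
  simp only [OccursAt, List.get_eq_getElem, List.length_append]
  constructor
  · refine fun h => ⟨fun j hj => ?_, fun j hj => ?_⟩
    · rw [h j (by omega), List.getElem_append_left hj]
    · have := h (w.length + j) (by omega)
      rw [List.getElem_append_right (by omega)] at this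
      simpa [add_assoc] using this
  · rintro ⟨h, h'⟩ j hj
    by_cases hjw : j < w.length
    · rw [h j hjw, List.getElem_append_left hjw]
    · have := h' (j - w.length) (by omega)
      rw [List.getElem_append_right (by omega), ← this]
      congr 1
      omega

theorem occursAt_singleton (b : A) (x : ℤ → A) (a : ℤ) :
    OccursAt [b] x a ↔ x a = b := by
  simp [OccursAt]

theorem OccursAt.eq_of_length_eq {w w' : List A} {x : ℤ → A} {a : ℤ}
    (h : OccursAt w x a) (h' : OccursAt w' x a) (hl : w.length = w'.length) : w = w' :=
  List.ext_getElem hl fun j hj hj' => (h j hj).symm.trans (h' j hj')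

theorem OccursAt.isSuffix {w w' : List A} {x : ℤ → A} {a : ℤ} (h : OccursAt w x a)
    (hl : w'.length ≤ w.length) (h' : OccursAt w' x (a + w.length - w'.length)) :
    w' <:+ w := by
  have hw := h
  rw [← List.take_append_drop (w.length - w'.length) w, occursAt_append] at hw
  have hd : OccursAt (w.drop (w.length - w'.length)) x (a + w.length - w'.length) := by
    convert hw.2 using 1
    rw [List.length_take, min_eq_left (by omega)]
    omega
  rw [h'.eq_of_length_eq hd (by rw [List.length_drop]; omega)]
  exact List.drop_suffix _ _

end Words

section Averaging

variable {n : ℕ} (T : Matrix (Fin n) (Fin n) ℝ)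

theorem fword_congr_length (S : Finset (List (Fin n))) (t : ℝ) {σ σ' : List (Fin n)}
    (h : σ.length = σ'.length) : fword S t σ = fword S t σ' := by
  unfold fword
  rw [h]

theorem mem_cylinder_append {σ τ : List (Fin n)} {x : ℤ → Fin n} :
    x ∈ cylinder T (σ ++ τ) ↔ x ∈ cylinder T σ ∧ OccursAt τ x σ.length := by
  simp only [cylinder, Set.mem_ofPred_eq, occursAt_append, zero_add, and_assoc]

theorem cylinder_append_subset (σ τ : List (Fin n)) :
    cylinder T (σ ++ τ) ⊆ cylinder T σ :=
  fun _ hx => ((mem_cylinder_append T).1 hx).1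

theorem iUnion_cylinder_append_singleton (σ : List (Fin n)) :
    ⋃ i, cylinder T (σ ++ [i]) = cylinder T σ := by
  ext x
  simp [mem_cylinder_append, occursAt_singleton]

theorem pairwise_disjoint_cylinder_append_singleton (σ : List (Fin n)) :
    Pairwise (Function.onFun Disjoint fun i => cylinder T (σ ++ [i])) := by
  refine fun i j hij => Set.disjoint_left.2 fun x hi hj => hij ?_
  rw [mem_cylinder_append, occursAt_singleton] at hi hj
  exact hi.2.symm.trans hj.2

theorem mul_fword_append_singleton (S : Finset (List (Fin n))) (t : ℝ)
    {σ : List (Fin n)} (hend : ∀ τ ∈ S, ¬ τ <:+ σ) (i : Fin n) {x : ℤ → Fin n}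
    (hx : x ∈ cylinder T σ) :
    t * fword S t (σ ++ [i]) x = fword S t σ x +
      ∑ τ ∈ S, (cylinder T (σ ++ τ)).indicator (fun _ => t ^ τ.length) x := by
  classical
  unfold fword
  rw [Finset.mul_sum, ← Finset.sum_add_distrib]
  refine Finset.sum_congr rfl fun τ hτ => ?_
  let F : ℕ → ℝ := fun k =>
    if τ.length ≤ σ.length + k ∧ OccursAt τ x ((σ.length : ℤ) + k - τ.length)
    then t ^ k else 0
  have h₀ : F 0 = 0 := by
    refine if_neg fun h => hend τ hτ (hx.2.isSuffix (by omega) ?_)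
    simpa using h.2
  have hlast : F τ.length =
      (cylinder T (σ ++ τ)).indicator (fun _ => t ^ τ.length) x := by
    simp [F, Set.indicator_apply, mem_cylinder_append, hx]
  have hshift : ∀ j, t * (if τ.length ≤ (σ ++ [i]).length + j ∧
      OccursAt τ x (((σ ++ [i]).length : ℤ) + j - τ.length) then t ^ j else 0) =
      F (j + 1) := by
    intro j
    have hl : (σ ++ [i]).length + j = σ.length + (j + 1) := by
      simp; omega
    have hz : ((σ ++ [i]).length : ℤ) + j = σ.length + ((j + 1 : ℕ) : ℤ) := by
      exact_mod_cast hl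
    simp only [F, hl, hz, mul_ite, mul_zero, pow_succ']
  rw [Finset.mul_sum, ← hlast, ← Finset.sum_range_succ F]
  simp only [hshift]
  rw [Finset.sum_range_succ', h₀, add_zero]

theorem measure_mul_weight (μ : Measure (ℤ → Fin n)) [IsFiniteMeasure μ]
    (S : Finset (List (Fin n))) (t : ℝ) (σ : List (Fin n)) :
    (μ (cylinder T σ)).toReal * weight T μ S t σ = ∫ x in cylinder T σ, fword S t σ x ∂μ := by
  refine mul_div_cancel_of_imp' fun h => setIntegral_measure_zero _ ?_
  exact (measureReal_eq_zero_iff).1 h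

theorem mul_setIntegral_fword_append_singleton (μ : Measure (ℤ → Fin n))
    [IsFiniteMeasure μ] (S : Finset (List (Fin n))) (t : ℝ) {σ : List (Fin n)}
    (hend : ∀ τ ∈ S, ¬ τ <:+ σ) (i : Fin n) :
    t * ∫ x in cylinder T σ, fword S t (σ ++ [i]) x ∂μ =
      (∫ x in cylinder T σ, fword S t σ x ∂μ) +
        ∑ τ ∈ S, (μ (cylinder T (σ ++ τ))).toReal * t ^ τ.length := by
  have hint : ∀ τ ∈ S, Integrable
      ((cylinder T (σ ++ τ)).indicator fun _ => t ^ τ.length) (μ.restrict (cylinder T σ)) :=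
    fun τ _ => (integrable_const _).indicator (measurableSet_cylinder T _)
  rw [← integral_const_mul, setIntegral_congr_fun (measurableSet_cylinder T σ)
    fun x hx => mul_fword_append_singleton T S t hend i hx,
    integral_add (integrable_fword μ S t σ).integrableOn (integrable_finsetSum _ hint),
    integral_finsetSum _ hint]
  congr 1
  refine Finset.sum_congr rfl fun τ _ => ?_
  rw [integral_indicator_const _ (measurableSet_cylinder T _), smul_eq_mul, measureReal_def,
    Measure.restrict_apply (measurableSet_cylinder T _),
    Set.inter_eq_left.2 (cylinder_append_subset T σ τ)]

end Averaging

/-- **Lemma 2 (weight averaging).** If the admissible word `σ` does not end in an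
element of `S`, then `(1/μ([σ]))·∑_i μ([σi])·w(σi) = (w(σ) + p_σ)/t`. -/
theorem weight_average
    {n : ℕ} [NeZero n] (T : Matrix (Fin n) (Fin n) ℝ) (lam : ℝ) (u v : Fin n → ℝ)
    (μ : Measure (ℤ → Fin n))
    (hT01 : ∀ i j, T i j = 0 ∨ T i j = 1)
    (hirr : ∀ i j : Fin n, ∃ m : ℕ, 0 < m ∧ 0 < (T ^ m) i j)
    (hlam : 1 < lam)
    (hu : ∀ i, 0 < u i) (hv : ∀ i, 0 < v i)
    (huT : Matrix.vecMul u T = lam • u)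
    (hTv : T.mulVec v = lam • v)
    (huv : ∑ i, u i * v i = 1)
    (hprob : IsProbabilityMeasure μ)
    (hinv : MeasurePreserving (fun (x : ℤ → Fin n) (i : ℤ) => x (i + 1)) μ μ)
    (hcyl : ∀ σ : List (Fin n), σ ≠ [] → Admissible T σ →
      μ (cylinder T σ) = ENNReal.ofReal (u σ.head! * v σ.getLast! / lam ^ (σ.length - 1)))
    (S : Finset (List (Fin n)))
    (hSne : ∀ τ ∈ S, τ ≠ [])
    (hSadm : ∀ τ ∈ S, Admissible T τ)
    (hSanti : ∀ τ ∈ S, ∀ τ' ∈ S, τ ≠ τ' → ¬ τ <:+: τ')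
    (t : ℝ) (ht : 0 < t)
    (σ : List (Fin n)) (hσ : Admissible T σ)
    (hend : ∀ τ ∈ S, ¬ τ <:+ σ) :
    (∑ i : Fin n, (μ (cylinder T (σ ++ [i]))).toReal * weight T μ S t (σ ++ [i])) /
        (μ (cylinder T σ)).toReal
      = (weight T μ S t σ + pWord T μ S t σ) / t := by
  have hsum : ∑ i : Fin n, (μ (cylinder T (σ ++ [i]))).toReal * weight T μ S t (σ ++ [i]) =
      ∫ x in cylinder T σ, fword S t (σ ++ [0]) x ∂μ := by
    rw [← iUnion_cylinder_append_singleton T σ, integral_iUnion_fintype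
      (fun i => measurableSet_cylinder T _) (pairwise_disjoint_cylinder_append_singleton T σ)
      fun i => (integrable_fword μ S t _).integrableOn]
    refine Finset.sum_congr rfl fun i _ => ?_
    rw [measure_mul_weight, fword_congr_length S t (σ' := σ ++ [0]) (by simp)]
  rw [hsum, eq_div_iff ht.ne', div_mul_eq_mul_div, mul_comm,
    mul_setIntegral_fword_append_singleton T μ S t hend 0, weight, pWord, add_div,
    Finset.sum_div]
  simp only [div_mul_eq_mul_div]

end SFT
end

section
/- Let λ > 1, C > 0, let N be a positive real, and let k, ℓ be integers with 1 ≤ k < ℓ satisfying 1 < (ℓ − k)·C·N < λ^{ℓ−2k}. Then the function r(t) = (1 + k·C·N·λ^{2k−ℓ}·t^{ℓ/k})/t on (0,∞) attains its minimum at t_min = λ^k·λ^{−2k²/ℓ}/((ℓ − k)·C·N)^{k/ℓ}, this minimizer satisfies t_min ∈ (1, λ^k), and the minimum value is r_min = (C·N·ℓ)^{k/ℓ}·(1 − k/ℓ)^{k/ℓ−1}·λ^{−k+2k²/ℓ}. -/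
open Filter MeasureTheory
open scoped BigOperators

namespace SFT

/-- If `(p - 1) * B * a ^ p = 1`, then `a` minimizes `t ↦ (1 + B * t ^ p) / t` on `(0, ∞)`. -/
theorem one_add_mul_rpow_div_le_of_critical {B p a t : ℝ} (hp : 1 < p) (ha : 0 < a)
    (ht : 0 < t) (hcrit : (p - 1) * (B * a ^ p) = 1) :
    (1 + B * a ^ p) / a ≤ (1 + B * t ^ p) / t := by
  have hbern : 1 + p * (t / a - 1) ≤ (t / a) ^ p := by
    have h := one_add_mul_self_le_rpow_one_add (s := t / a - 1)
      (by linarith [div_pos ht ha]) hp.le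
    rwa [add_sub_cancel] at h
  have hsplit : t ^ p = (t / a) ^ p * a ^ p := by
    rw [← Real.mul_rpow (div_pos ht ha).le ha.le, div_mul_cancel₀ _ ha.ne']
  have hD : 0 < B * a ^ p := by
    by_contra! h
    nlinarith
  have hBt : B * t ^ p = B * a ^ p * (t / a) ^ p := by rw [hsplit]; ring
  rw [le_div_iff₀ ht, hBt]
  calc (1 + B * a ^ p) / a * t = (1 + B * a ^ p) * (t / a) := by ring
    _ = 1 + B * a ^ p * (1 + p * (t / a - 1)) := by linear_combination (1 - t / a) * hcrit
    _ ≤ 1 + B * a ^ p * (t / a) ^ p := by gcongr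

/-- **Optimization of `r`.** For `1 ≤ k < ℓ` with `1 < (ℓ-k)·C·N < λ^{ℓ-2k}`, the
function `r(t) = (1 + k·C·N·λ^{2k-ℓ}·t^{ℓ/k})/t` on `(0,∞)` attains its minimum at
`t_min = λ^k·λ^{-2k²/ℓ}/((ℓ-k)·C·N)^{k/ℓ} ∈ (1, λ^k)`, with minimum value
`r_min = (C·N·ℓ)^{k/ℓ}·(1-k/ℓ)^{k/ℓ-1}·λ^{-k+2k²/ℓ}`. -/
theorem rmin_formula
    (lam C N : ℝ) (k l : ℕ)
    (hlam : 1 < lam) (hC : 0 < C) (hN : 0 < N)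
    (hk : 1 ≤ k) (hkl : k < l)
    (h1 : 1 < ((l : ℝ) - k) * C * N)
    (h2 : ((l : ℝ) - k) * C * N < lam ^ ((l : ℝ) - 2 * k)) :
    (1 : ℝ) < lam ^ (k : ℝ) * lam ^ (-(2 * (k : ℝ) ^ 2) / l) /
        (((l : ℝ) - k) * C * N) ^ ((k : ℝ) / l) ∧
    lam ^ (k : ℝ) * lam ^ (-(2 * (k : ℝ) ^ 2) / l) /
        (((l : ℝ) - k) * C * N) ^ ((k : ℝ) / l) < lam ^ (k : ℝ) ∧
    (∀ t ∈ Set.Ioi (0 : ℝ),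
      (1 + k * C * N * lam ^ (2 * (k : ℝ) - l) *
          (lam ^ (k : ℝ) * lam ^ (-(2 * (k : ℝ) ^ 2) / l) /
            (((l : ℝ) - k) * C * N) ^ ((k : ℝ) / l)) ^ ((l : ℝ) / k)) /
        (lam ^ (k : ℝ) * lam ^ (-(2 * (k : ℝ) ^ 2) / l) /
          (((l : ℝ) - k) * C * N) ^ ((k : ℝ) / l)) ≤
      (1 + k * C * N * lam ^ (2 * (k : ℝ) - l) * t ^ ((l : ℝ) / k)) / t) ∧
    (1 + k * C * N * lam ^ (2 * (k : ℝ) - l) *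
        (lam ^ (k : ℝ) * lam ^ (-(2 * (k : ℝ) ^ 2) / l) /
          (((l : ℝ) - k) * C * N) ^ ((k : ℝ) / l)) ^ ((l : ℝ) / k)) /
      (lam ^ (k : ℝ) * lam ^ (-(2 * (k : ℝ) ^ 2) / l) /
        (((l : ℝ) - k) * C * N) ^ ((k : ℝ) / l)) =
      (C * N * l) ^ ((k : ℝ) / l) * (1 - (k : ℝ) / l) ^ ((k : ℝ) / l - 1) *
        lam ^ (-(k : ℝ) + 2 * (k : ℝ) ^ 2 / l) := by
  have hk0 : (0 : ℝ) < k := by exact_mod_cast hk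
  have hkl' : (k : ℝ) < l := by exact_mod_cast hkl
  have hl0 : (0 : ℝ) < l := hk0.trans hkl'
  have hd : (0 : ℝ) < l - k := sub_pos.2 hkl'
  have hlam0 : 0 < lam := one_pos.trans hlam
  have hA0 : 0 < ((l : ℝ) - k) * C * N := one_pos.trans h1
  have hCN : 0 < C * N := mul_pos hC hN
  set a : ℝ := lam ^ (k : ℝ) * lam ^ (-(2 * (k : ℝ) ^ 2) / l) /
    (((l : ℝ) - k) * C * N) ^ ((k : ℝ) / l) with ha_def
  have ha : 0 < a := by positivity
  have ha_eq : a = (lam ^ ((l : ℝ) - 2 * k) / (((l : ℝ) - k) * C * N)) ^ ((k : ℝ) / l) := by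
    rw [ha_def, Real.div_rpow (by positivity) hA0.le, ← Real.rpow_mul hlam0.le,
      ← Real.rpow_add hlam0]
    congr 2
    field_simp
    ring
  have ha_pow : a ^ ((l : ℝ) / k) = lam ^ ((l : ℝ) - 2 * k) / (((l : ℝ) - k) * C * N) := by
    rw [ha_eq, ← Real.rpow_mul (by positivity), div_mul_div_cancel₀ hl0.ne', div_self hk0.ne',
      Real.rpow_one]
  have hval : k * C * N * lam ^ (2 * (k : ℝ) - l) * a ^ ((l : ℝ) / k) = k / (l - k) := by
    have hinv : lam ^ (2 * (k : ℝ) - l) * lam ^ ((l : ℝ) - 2 * k) = 1 := by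
      rw [← Real.rpow_add hlam0, sub_add_sub_cancel, sub_self, Real.rpow_zero]
    rw [ha_pow]
    generalize lam ^ (2 * (k : ℝ) - l) = u at hinv ⊢
    generalize lam ^ ((l : ℝ) - 2 * k) = v at hinv ⊢
    field_simp
    linear_combination hinv
  refine ⟨?_, ?_, fun t ht => ?_, ?_⟩
  · rw [ha_eq]
    exact Real.one_lt_rpow ((one_lt_div hA0).2 h2) (by positivity)
  · rw [ha_def, div_lt_iff₀ (by positivity)]
    refine mul_lt_mul_of_pos_left ?_ (by positivity)
    refine (Real.rpow_lt_one_of_one_lt_of_neg hlam ?_).trans (Real.one_lt_rpow h1 (by positivity))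
    exact div_neg_of_neg_of_pos (neg_lt_zero.2 (by positivity)) hl0
  · refine one_add_mul_rpow_div_le_of_critical ((one_lt_div hk0).2 hkl') ha ht ?_
    rw [hval]
    field_simp
  · have hfrac : 1 - (k : ℝ) / l = (l - k) / l := by field_simp
    have hsplit : ((l : ℝ) - k) * C * N = C * N * l * ((l - k) / l) := by field_simp
    have hexp : lam ^ (-(k : ℝ) + 2 * (k : ℝ) ^ 2 / l) =
        (lam ^ (k : ℝ) * lam ^ (-(2 * (k : ℝ) ^ 2) / l))⁻¹ := by
      rw [← Real.rpow_add hlam0, ← Real.rpow_neg hlam0.le]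
      congr 1
      ring
    rw [hval, hfrac, hexp, Real.rpow_sub_one (by positivity), ha_def, hsplit,
      Real.mul_rpow (by positivity) (by positivity)]
    field_simp
    ring

end SFT
end
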